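/- Let S ∈ ℝ^{m×n}, T ∈ ℝ^{k×n}, s ∈ ℝ^m, t ∈ ℝ^k, and assume the polyhedron {x ∈ ℝⁿ : Tx ≤ t} is nonempty. Then the following are equivalent: (1) every x with Tx ≤ t satisfies Sx ≥ s; (2) for each i = 1, …, m the linear program min{(Sx)_i : Tx ≤ t} has an optimal solution and its optimal value is at least s_i; (3) there exists a matrix W ∈ ℝ^{m×k} with W ≥ 0 entrywise such that S + WT = 0 and s + Wt ≤ 0. -/

import Mathlib

open Module in
/-- **Farkas' lemma** for finitely many linear functionals on a vector space over an ordered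
field. -/
theorem exists_nonneg_sum_smul_eq_of_forall_nonpos {𝕜 E : Type*} [Field 𝕜] [LinearOrder 𝕜]
    [IsStrictOrderedRing 𝕜] [AddCommGroup E] [Module 𝕜 E] {k : ℕ} (a : Fin k → Dual 𝕜 E)
    (b : Dual 𝕜 E) (h : ∀ x, (∀ j, a j x ≤ 0) → b x ≤ 0) :
    ∃ w : Fin k → 𝕜, (∀ j, 0 ≤ w j) ∧ ∑ j, w j • a j = b := by
  induction k generalizing b with
  | zero =>
    refine ⟨0, fun j => le_rfl, ?_⟩
    ext x
    have h₁ := h x (fun j => j.elim0)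
    have h₂ := h (-x) (fun j => j.elim0)
    rw [map_neg] at h₂
    simp only [Finset.univ_eq_empty, Finset.sum_empty, LinearMap.zero_apply]
    linarith
  | succ k ih =>
    by_cases hb : ∀ x, (∀ j : Fin k, a j.castSucc x ≤ 0) → b x ≤ 0
    · obtain ⟨w, hw, rfl⟩ := ih _ b hb
      refine ⟨Fin.snoc w 0, fun j => ?_, by simp [Fin.sum_univ_castSucc]⟩
      induction j using Fin.lastCases <;> simp [hw]
    · push Not at hb
      obtain ⟨x₀, ha₀, hb₀⟩ := hb
      have hl : 0 < a (Fin.last k) x₀ := by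
        by_contra! hl
        refine hb₀.not_ge (h x₀ fun j => ?_)
        induction j using Fin.lastCases with
        | last => exact hl
        | cast j => exact ha₀ j
      set l := a (Fin.last k) with hl_def
      obtain ⟨w, hw, hwb⟩ := ih (fun j => a j.castSucc - (a j.castSucc x₀ / l x₀) • l)
        (b - (b x₀ / l x₀) • l) (fun x hx => by
          have key (f : Dual 𝕜 E) :
              (f - (f x₀ / l x₀) • l) x = f (x - (l x / l x₀) • x₀) := by
            simp only [LinearMap.sub_apply, LinearMap.smul_apply, smul_eq_mul, map_sub, map_smul]
            ring
          rw [key]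
          refine h _ fun j => ?_
          induction j using Fin.lastCases with
          | last => simp [← hl_def, div_mul_cancel₀ _ hl.ne']
          | cast j => rw [← key]; exact hx j)
      refine ⟨Fin.snoc w (b x₀ / l x₀ - ∑ j, w j * (a j.castSucc x₀ / l x₀)), fun j => ?_, ?_⟩
      · induction j using Fin.lastCases with
        | last =>
          rw [Fin.snoc_last, sub_nonneg]
          exact (Finset.sum_nonpos fun j _ => mul_nonpos_of_nonneg_of_nonpos (hw j)
            (div_nonpos_of_nonpos_of_nonneg (ha₀ j) hl.le)).trans (div_nonneg hb₀.le hl.le)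
        | cast j => simpa using hw j
      · ext x
        have := LinearMap.congr_fun hwb x
        simp only [LinearMap.sum_apply, LinearMap.smul_apply, LinearMap.sub_apply, smul_eq_mul,
          mul_sub, Finset.sum_sub_distrib, ← mul_assoc, ← Finset.sum_mul] at this
        simp only [Fin.sum_univ_castSucc, Fin.snoc_castSucc, Fin.snoc_last, ← hl_def,
          LinearMap.add_apply, LinearMap.sum_apply, LinearMap.smul_apply, smul_eq_mul, sub_mul]
        linarith

open Module in
/-- **Gale's theorem of the alternative**: an infeasible finite system of affine inequalities has
a nonnegative combination which is contradictory. -/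
theorem exists_nonneg_sum_smul_eq_zero_of_infeasible {𝕜 E : Type*} [Field 𝕜] [LinearOrder 𝕜]
    [IsStrictOrderedRing 𝕜] [AddCommGroup E] [Module 𝕜 E] {k : ℕ} (a : Fin k → Dual 𝕜 E)
    (β : Fin k → 𝕜) (h : ¬ ∃ x, ∀ j, a j x ≤ β j) :
    ∃ w : Fin k → 𝕜, (∀ j, 0 ≤ w j) ∧ ∑ j, w j • a j = 0 ∧ ∑ j, w j * β j < 0 := by
  obtain ⟨w, hw, hwb⟩ := exists_nonneg_sum_smul_eq_of_forall_nonpos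
    (fun j => a j ∘ₗ LinearMap.fst 𝕜 E 𝕜 - β j • LinearMap.snd 𝕜 E 𝕜) (LinearMap.snd 𝕜 E 𝕜) (by
      rintro ⟨x, τ⟩ hx
      by_contra! hτ
      have hτ : 0 < τ := hτ
      refine h ⟨τ⁻¹ • x, fun j => ?_⟩
      have := hx j
      simp only [LinearMap.sub_apply, LinearMap.comp_apply, LinearMap.smul_apply,
        LinearMap.fst_apply, LinearMap.snd_apply, smul_eq_mul, sub_nonpos] at this
      rw [map_smul, smul_eq_mul, inv_mul_le_iff₀ hτ, mul_comm]
      exact this)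
  refine ⟨w, hw, ?_, ?_⟩
  · ext x
    simpa using LinearMap.congr_fun hwb (x, 0)
  · have := LinearMap.congr_fun hwb (0, 1)
    simp at this
    linarith

open Module in
/-- The affine form of Farkas' lemma: an affine inequality implied by a feasible finite system of
affine inequalities is dominated by a nonnegative combination of the system. -/
theorem exists_nonneg_sum_smul_eq_of_forall_le {𝕜 E : Type*} [Field 𝕜] [LinearOrder 𝕜]
    [IsStrictOrderedRing 𝕜] [AddCommGroup E] [Module 𝕜 E] {k : ℕ} (a : Fin k → Dual 𝕜 E)
    (β : Fin k → 𝕜) (b : Dual 𝕜 E) (γ : 𝕜) (hne : ∃ x, ∀ j, a j x ≤ β j)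
    (h : ∀ x, (∀ j, a j x ≤ β j) → b x ≤ γ) :
    ∃ w : Fin k → 𝕜, (∀ j, 0 ≤ w j) ∧ ∑ j, w j • a j = b ∧ ∑ j, w j * β j ≤ γ := by
  obtain ⟨x₀, hx₀⟩ := hne
  obtain ⟨w, hw, hwb⟩ := exists_nonneg_sum_smul_eq_of_forall_nonpos
    (Fin.snoc (fun j => a j ∘ₗ LinearMap.fst 𝕜 E 𝕜 - β j • LinearMap.snd 𝕜 E 𝕜)
      (-LinearMap.snd 𝕜 E 𝕜) : Fin (k + 1) → Dual 𝕜 (E × 𝕜))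
    (b ∘ₗ LinearMap.fst 𝕜 E 𝕜 - γ • LinearMap.snd 𝕜 E 𝕜) (by
      rintro ⟨x, τ⟩ hx
      have hτ : 0 ≤ τ := by simpa using hx (Fin.last k)
      have ha (j : Fin k) : a j x ≤ β j * τ := by simpa using hx j.castSucc
      suffices b x ≤ γ * τ by simpa using this
      rcases hτ.eq_or_lt with rfl | hτ
      · by_contra! hb
        rw [mul_zero] at hb
        have hlam : 0 ≤ (γ - b x₀ + 1) / b x :=
          div_nonneg (by linarith [h x₀ hx₀]) hb.le
        have := h (x₀ + ((γ - b x₀ + 1) / b x) • x) fun j => by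
          rw [map_add, map_smul, smul_eq_mul]
          have := mul_nonpos_of_nonneg_of_nonpos hlam ((ha j).trans_eq (mul_zero _))
          linarith [hx₀ j]
        rw [map_add, map_smul, smul_eq_mul, div_mul_cancel₀ _ hb.ne'] at this
        linarith
      · have := h (τ⁻¹ • x) fun j => by
          rw [map_smul, smul_eq_mul, inv_mul_le_iff₀ hτ, mul_comm]
          exact ha j
        rwa [map_smul, smul_eq_mul, inv_mul_le_iff₀ hτ, mul_comm] at this)
  rw [Fin.sum_univ_castSucc] at hwb
  simp only [Fin.snoc_castSucc, Fin.snoc_last] at hwb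
  refine ⟨fun j => w j.castSucc, fun j => hw _, ?_, ?_⟩
  · ext x
    simpa using LinearMap.congr_fun hwb (x, 0)
  · have := LinearMap.congr_fun hwb (0, 1)
    simp at this
    linarith [hw (Fin.last k)]

open Module in
/-- A linear functional that is bounded below on a nonempty polyhedron attains its minimum. -/
theorem exists_forall_le_of_bddBelow_polyhedron {E : Type*} [AddCommGroup E] [Module ℝ E] {k : ℕ}
    (a : Fin k → Dual ℝ E) (β : Fin k → ℝ) (c : Dual ℝ E) (hne : ∃ x, ∀ j, a j x ≤ β j)
    (hc : BddBelow (c '' {x | ∀ j, a j x ≤ β j})) :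
    ∃ x, (∀ j, a j x ≤ β j) ∧ ∀ y, (∀ j, a j y ≤ β j) → c x ≤ c y := by
  set v := sInf (c '' {x | ∀ j, a j x ≤ β j})
  have hle (y : E) (hy : ∀ j, a j y ≤ β j) : v ≤ c y := csInf_le hc ⟨y, hy, rfl⟩
  suffices ∃ x, (∀ j, a j x ≤ β j) ∧ c x ≤ v by
    obtain ⟨x, hx, hxv⟩ := this
    exact ⟨x, hx, fun y hy => hxv.trans (hle y hy)⟩
  by_contra hinf
  obtain ⟨w, hw, hwa, hwβ⟩ := exists_nonneg_sum_smul_eq_zero_of_infeasible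
    (Fin.snoc a c : Fin (k + 1) → Dual ℝ E) (Fin.snoc β v : Fin (k + 1) → ℝ) (by
      rintro ⟨x, hx⟩
      exact hinf ⟨x, fun j => by simpa using hx j.castSucc, by simpa using hx (Fin.last k)⟩)
  simp only [Fin.sum_univ_castSucc, Fin.snoc_castSucc, Fin.snoc_last] at hwa hwβ
  have hlow (y : E) (hy : ∀ j, a j y ≤ β j) :
      -∑ j : Fin k, w j.castSucc * β j ≤ w (Fin.last k) * c y := by
    have h₁ := LinearMap.congr_fun hwa y
    simp only [LinearMap.add_apply, LinearMap.sum_apply, LinearMap.smul_apply, smul_eq_mul,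
      LinearMap.zero_apply] at h₁
    have h₂ : ∑ j : Fin k, w j.castSucc * a j y ≤ ∑ j : Fin k, w j.castSucc * β j :=
      Finset.sum_le_sum fun j _ => mul_le_mul_of_nonneg_left (hy j) (hw _)
    linarith
  obtain ⟨x₀, hx₀⟩ := hne
  rcases (hw (Fin.last k)).eq_or_lt with h0 | hpos
  · have := hlow x₀ hx₀
    rw [← h0] at this hwβ
    linarith
  · have : (-∑ j : Fin k, w j.castSucc * β j) / w (Fin.last k) ≤ v := by
      refine le_csInf ⟨_, x₀, hx₀, rfl⟩ ?_
      rintro _ ⟨y, hy, rfl⟩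
      rw [div_le_iff₀' hpos]
      exact hlow y hy
    rw [div_le_iff₀' hpos] at this
    linarith

/-- Mangasarian: For `S ∈ ℝ^{m×n}`, `T ∈ ℝ^{k×n}`, `s ∈ ℝ^m`, `t ∈ ℝ^k`
with `{x : Tx ≤ t}` nonempty, the following are equivalent:
(1) `Tx ≤ t → Sx ≥ s`;
(2) for each `i`, the LP `min {(Sx)_i : Tx ≤ t}` has an optimal solution with value `≥ s_i`;
(3) there is an entrywise nonnegative `W ∈ ℝ^{m×k}` with `S + WT = 0` and `s + Wt ≤ 0`. -/
theorem stmt9 (m n k : ℕ)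
    (S : Matrix (Fin m) (Fin n) ℝ) (T : Matrix (Fin k) (Fin n) ℝ)
    (s : Fin m → ℝ) (t : Fin k → ℝ)
    (hne : ∃ x : Fin n → ℝ, ∀ j, T.mulVec x j ≤ t j) :
    List.TFAE
      [ ∀ x : Fin n → ℝ, (∀ j, T.mulVec x j ≤ t j) → ∀ i, s i ≤ S.mulVec x i,
        ∀ i : Fin m, ∃ x : Fin n → ℝ, (∀ j, T.mulVec x j ≤ t j) ∧
          (∀ y : Fin n → ℝ, (∀ j, T.mulVec y j ≤ t j) → S.mulVec x i ≤ S.mulVec y i) ∧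
          s i ≤ S.mulVec x i,
        ∃ W : Matrix (Fin m) (Fin k) ℝ, (∀ i j, 0 ≤ W i j) ∧
          S + W * T = 0 ∧ ∀ i, s i + W.mulVec t i ≤ 0 ] := by
  let row {p : ℕ} (A : Matrix (Fin p) (Fin n) ℝ) (i : Fin p) : Module.Dual ℝ (Fin n → ℝ) :=
    LinearMap.proj i ∘ₗ A.mulVecLin
  tfae_have 1 → 2 := by
    intro h i
    obtain ⟨x, hx, hmin⟩ := exists_forall_le_of_bddBelow_polyhedron (row T) t (row S i) hne
      ⟨s i, by rintro _ ⟨y, hy, rfl⟩; exact h y hy i⟩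
    exact ⟨x, hx, hmin, h x hx i⟩
  tfae_have 2 → 1 := by
    intro h x hx i
    obtain ⟨y, -, hmin, hs⟩ := h i
    exact hs.trans (hmin x hx)
  tfae_have 1 → 3 := by
    intro h
    have hex (i : Fin m) := exists_nonneg_sum_smul_eq_of_forall_le (row T) t (-row S i) (-s i) hne
      fun x hx => neg_le_neg (h x hx i)
    choose W hW hWT hWt using hex
    refine ⟨Matrix.of W, hW, ?_, fun i => ?_⟩
    · ext i l
      have := LinearMap.congr_fun (hWT i) (Pi.single l 1)
      simp [row] at this
      simp [Matrix.mul_apply, this]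
    · have := hWt i
      simp only [Matrix.mulVec, dotProduct, Matrix.of_apply]
      linarith
  tfae_have 3 → 1 := by
    rintro ⟨W, hW, hWT, hWt⟩ x hx i
    have h₁ : S.mulVec x i + W.mulVec (T.mulVec x) i = 0 := by
      rw [Matrix.mulVec_mulVec, ← Pi.add_apply, ← Matrix.add_mulVec, hWT, Matrix.zero_mulVec,
        Pi.zero_apply]
    have h₂ : W.mulVec (T.mulVec x) i ≤ W.mulVec t i :=
      dotProduct_le_dotProduct_of_nonneg_left hx (hW i)
    linarith [hWt i]
  tfae_finish
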